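/- Let G be a finite simple bipartite graph that has at least one perfect matching. Then f_f(G) = f(G), i.e., the minimum of f_f(G,γ) over all fractional perfect matchings γ of G equals the minimum of f(G,M) over all perfect matchings M of G. -/

import Mathlib

open Finset

variable {V : Type} [Fintype V] [DecidableEq V]

/-- The sum of `γ` over the edges of `G` incident with the vertex `v`.
(Functions on `E(G)` are encoded as functions on `Sym2 V` vanishing off the edge set.) -/
def vertexSum (G : SimpleGraph V) [DecidableRel G.Adj] (γ : Sym2 V → ℝ) (v : V) : ℝ :=
  ∑ e ∈ G.edgeFinset, if v ∈ e then γ e else 0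

/-- `γ` is a fractional perfect matching of `G`. -/
def IsFPM (G : SimpleGraph V) [DecidableRel G.Adj] (γ : Sym2 V → ℝ) : Prop :=
  (∀ e, 0 ≤ γ e) ∧ (∀ e ∉ G.edgeSet, γ e = 0) ∧ ∀ v, vertexSum G γ v = 1

/-- `α ↑ γ` : `α` is a (nonnegative) forcing function for the fractional perfect matching
`γ`, i.e. `α ⪯ γ` and `γ` is the unique fractional perfect matching `γ'` with `α ⪯ γ'`. -/
def IsForcing (G : SimpleGraph V) [DecidableRel G.Adj] (α γ : Sym2 V → ℝ) : Prop :=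
  (∀ e, 0 ≤ α e) ∧ (∀ e ∉ G.edgeSet, α e = 0) ∧ α ≤ γ ∧
    ∀ γ', IsFPM G γ' → α ≤ γ' → γ' = γ

/-- `|α|`, the sum of the values of `α` over all edges of `G`. -/
def eSum (G : SimpleGraph V) [DecidableRel G.Adj] (α : Sym2 V → ℝ) : ℝ :=
  ∑ e ∈ G.edgeFinset, α e

/-- The fractional forcing number `f_f(G,γ) = min {|α| : α ↑ γ}`. -/
noncomputable def ffN (G : SimpleGraph V) [DecidableRel G.Adj] (γ : Sym2 V → ℝ) : ℝ :=
  sInf {x : ℝ | ∃ α, IsForcing G α γ ∧ x = eSum G α}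

/-- `f_f(G)`, the minimum of `f_f(G,γ)` over all fractional perfect matchings `γ`. -/
noncomputable def ffMin (G : SimpleGraph V) [DecidableRel G.Adj] : ℝ :=
  sInf {x : ℝ | ∃ γ, IsFPM G γ ∧ ffN G γ = x}

/-- `F_f(G)`, the maximum of `f_f(G,γ)` over all fractional perfect matchings `γ`. -/
noncomputable def ffMax (G : SimpleGraph V) [DecidableRel G.Adj] : ℝ :=
  sSup {x : ℝ | ∃ γ, IsFPM G γ ∧ ffN G γ = x}

/-- `M` is a perfect matching of `G`: a set of pairwise disjoint edges covering every
vertex, i.e. every vertex lies in exactly one edge of `M`. -/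
def IsPM (G : SimpleGraph V) (M : Finset (Sym2 V)) : Prop :=
  ↑M ⊆ G.edgeSet ∧ ∀ v : V, ∃! e, e ∈ M ∧ v ∈ e

/-- The characteristic function `𝟙_M` of a set of edges `M`. -/
def charF (M : Finset (Sym2 V)) : Sym2 V → ℝ := fun e => if e ∈ M then 1 else 0

/-- `S` is a forcing set for the perfect matching `M`: `S ⊆ M` and `M` is the unique
perfect matching of `G` containing `S`. -/
def IsForcingSet (G : SimpleGraph V) (S : Set (Sym2 V)) (M : Finset (Sym2 V)) : Prop :=
  S ⊆ ↑M ∧ ∀ M', IsPM G M' → S ⊆ ↑M' → M' = M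

/-- The forcing number `f(G,M)`: the minimum size of a forcing set for `M`. -/
noncomputable def fN (G : SimpleGraph V) (M : Finset (Sym2 V)) : ℕ :=
  sInf {n : ℕ | ∃ S : Finset (Sym2 V), IsForcingSet G ↑S M ∧ S.card = n}

/-- `f(G)`, the minimum of `f(G,M)` over all perfect matchings `M` of `G`. -/
noncomputable def fMin (G : SimpleGraph V) : ℕ :=
  sInf {n : ℕ | ∃ M, IsPM G M ∧ fN G M = n}

omit [Fintype V] [DecidableEq V] in
lemma IsPM.eq_of_subset {G : SimpleGraph V} {M M' : Finset (Sym2 V)} (hM : IsPM G M)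
    (hM' : IsPM G M') (h : M ⊆ M') : M' = M := by
  refine (Finset.Subset.antisymm h fun e he => ?_).symm
  obtain ⟨v, hv⟩ : ∃ v, v ∈ e := ⟨_, e.out_fst_mem⟩
  obtain ⟨e', ⟨he', hv'⟩, -⟩ := hM.2 v
  rwa [(hM'.2 v).unique ⟨he, hv⟩ ⟨h he', hv'⟩]

omit [Fintype V] [DecidableEq V] in
lemma isForcingSet_self {G : SimpleGraph V} {M : Finset (Sym2 V)} (hM : IsPM G M) :
    IsForcingSet G ↑M M :=
  ⟨subset_rfl, fun _ hM' h => hM.eq_of_subset hM' (Finset.coe_subset.1 h)⟩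

omit [Fintype V] [DecidableEq V] in
lemma exists_isForcingSet_card_eq_fN {G : SimpleGraph V} {M : Finset (Sym2 V)}
    (hM : IsPM G M) : ∃ S : Finset (Sym2 V), IsForcingSet G ↑S M ∧ S.card = fN G M :=
  Nat.sInf_mem (s := {n : ℕ | ∃ S : Finset (Sym2 V), IsForcingSet G ↑S M ∧ S.card = n})
    ⟨_, M, isForcingSet_self hM, rfl⟩

omit [Fintype V] [DecidableEq V] in
lemma exists_isPM_fN_eq_fMin {G : SimpleGraph V} (hM : ∃ M, IsPM G M) :
    ∃ M, IsPM G M ∧ fN G M = fMin G :=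
  Nat.sInf_mem (s := {n : ℕ | ∃ M, IsPM G M ∧ fN G M = n})
    (hM.imp' (fN G) fun M h => ⟨M, h, rfl⟩)

omit [Fintype V] [DecidableEq V] in
lemma fMin_le_card {G : SimpleGraph V} {M S : Finset (Sym2 V)} (hM : IsPM G M)
    (hS : IsForcingSet G ↑S M) : fMin G ≤ S.card :=
  le_trans (Nat.sInf_le ⟨M, hM, rfl⟩) (Nat.sInf_le ⟨S, hS, rfl⟩)

omit [Fintype V] in
lemma charF_nonneg (M : Finset (Sym2 V)) (e : Sym2 V) : 0 ≤ charF M e := by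
  unfold charF; split_ifs <;> norm_num

omit [Fintype V] in
lemma sum_charF (s M : Finset (Sym2 V)) : ∑ e ∈ s, charF M e = ((s ∩ M).card : ℝ) := by
  simp [charF]

omit [Fintype V] in
lemma charF_le_iff_of_nonneg {S : Finset (Sym2 V)} {γ : Sym2 V → ℝ} (hγ : ∀ e, 0 ≤ γ e) :
    charF S ≤ γ ↔ ∀ e ∈ S, 1 ≤ γ e := by
  refine ⟨fun h e he => by simpa [charF, he] using h e, fun h e => ?_⟩
  unfold charF
  split_ifs with he
  exacts [h e he, hγ e]

section

variable {G : SimpleGraph V} [DecidableRel G.Adj]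

lemma IsPM.isFPM {M : Finset (Sym2 V)} (hM : IsPM G M) : IsFPM G (charF M) := by
  refine ⟨charF_nonneg M, fun e he => if_neg fun h => he (hM.1 h), fun v => ?_⟩
  obtain ⟨e, ⟨he, hv⟩, hu⟩ := hM.2 v
  rw [vertexSum, Finset.sum_eq_single e]
  · simp [hv, charF, he]
  · intro e' _ hne
    split_ifs with hv'
    · exact if_neg fun h => hne (hu e' ⟨h, hv'⟩)
    · rfl
  · exact fun h => absurd (SimpleGraph.mem_edgeFinset.2 (hM.1 he)) h

lemma IsFPM.sum_apply_mk {γ : Sym2 V → ℝ} (hγ : IsFPM G γ) (v : V) :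
    ∑ u, γ s(v, u) = 1 := by
  rw [← hγ.2.2 v, vertexSum, Finset.sum_subset (Finset.subset_univ G.edgeFinset)
    (fun e _ he => by simp [hγ.2.1 e (by simpa using he)])]
  refine Finset.sum_of_injOn (fun u => s(v, u)) (fun a _ b _ h => Sym2.congr_right.1 h)
    (fun _ _ => by simp) (fun e _ he => if_neg ?_) (fun u _ => by simp)
  rintro ⟨u, rfl⟩
  exact he ⟨u, by simp, rfl⟩

lemma IsFPM.eq_of_le {γ γ' : Sym2 V → ℝ} (hγ : IsFPM G γ) (hγ' : IsFPM G γ') (h : γ ≤ γ') :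
    γ' = γ := by
  funext e
  induction e with
  | _ v u =>
    have := (Finset.sum_eq_sum_iff_of_le fun u _ => h s(v, u)).1
      ((hγ.sum_apply_mk v).trans (hγ'.sum_apply_mk v).symm)
    exact (this u (Finset.mem_univ u)).symm

lemma IsFPM.isForcing_self {γ : Sym2 V → ℝ} (hγ : IsFPM G γ) : IsForcing G γ γ :=
  ⟨hγ.1, hγ.2.1, le_rfl, fun _ hγ' h => hγ.eq_of_le hγ' h⟩

omit [DecidableRel G.Adj] in
lemma isPM_image_perm (C : G.Coloring (Fin 2)) {σ : Equiv.Perm V}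
    (hσ : ∀ v, G.Adj v (σ v)) :
    IsPM G ((Finset.univ.filter fun v => C v = 0).image fun v => s(v, σ v)) := by
  constructor
  · intro e he
    obtain ⟨v, -, rfl⟩ := Finset.mem_image.1 he
    exact hσ v
  · intro v
    by_cases hv : C v = 0
    · refine ⟨s(v, σ v), ⟨Finset.mem_image.2 ⟨v, by simp [hv], rfl⟩, by simp⟩, ?_⟩
      rintro e ⟨he, hve⟩
      obtain ⟨u, hu, rfl⟩ := Finset.mem_image.1 he
      have hu : C u = 0 := by simpa using hu
      rcases Sym2.mem_iff.1 hve with rfl | rfl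
      · rfl
      · exact absurd (hu.trans hv.symm) (C.valid (hσ u))
    · obtain ⟨w, rfl⟩ := σ.surjective v
      have hw : C w = 0 := by have := C.valid (hσ w); lia
      refine ⟨s(w, σ w), ⟨Finset.mem_image.2 ⟨w, by simp [hw], rfl⟩, by simp⟩, ?_⟩
      rintro e ⟨he, hve⟩
      obtain ⟨u, hu, rfl⟩ := Finset.mem_image.1 he
      have hu : C u = 0 := by simpa using hu
      rcases Sym2.mem_iff.1 hve with h | h
      · exact absurd (h ▸ hu) hv
      · rw [σ.injective h]

/-- Birkhoff's theorem for fractional perfect matchings of bipartite graphs. -/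
lemma IsFPM.mem_convexHull (hbip : G.Colorable 2) {γ : Sym2 V → ℝ} (hγ : IsFPM G γ) :
    γ ∈ convexHull ℝ (charF '' {M | IsPM G M}) := by
  obtain ⟨C⟩ := hbip
  have hA : Matrix.of (fun v u => γ s(v, u)) ∈ doublyStochastic ℝ V := by
    refine mem_doublyStochastic_iff_sum.2 ⟨fun _ _ => hγ.1 _, hγ.sum_apply_mk, fun v => ?_⟩
    simpa only [Matrix.of_apply, Sym2.eq_swap] using hγ.sum_apply_mk v
  obtain ⟨w, hw0, hw1, hw⟩ := exists_eq_sum_perm_of_mem_doublyStochastic hA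
  have hent : ∀ v u, γ s(v, u) = ∑ σ, if σ v = u then w σ else 0 := fun v u => by
    have := congrFun (congrFun hw v) u
    simpa [Matrix.sum_apply, Equiv.Perm.permMatrix, PEquiv.toMatrix_apply, eq_comm]
      using this.symm
  have hadj : ∀ σ, w σ ≠ 0 → ∀ v, G.Adj v (σ v) := fun σ hσ v => by
    by_contra h
    have h0 := hγ.2.1 s(v, σ v) h
    rw [hent, Finset.sum_eq_zero_iff_of_nonneg
      (fun τ _ => by split_ifs; exacts [hw0 τ, le_rfl])] at h0
    exact hσ (by simpa using h0 σ (Finset.mem_univ σ))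
  let M : Equiv.Perm V → Finset (Sym2 V) := fun σ =>
    (Finset.univ.filter fun v => C v = 0).image fun v => s(v, σ v)
  have hM : ∀ σ, w σ ≠ 0 → IsPM G (M σ) := fun σ hσ => isPM_image_perm C (hadj σ hσ)
  have hcol : ∀ σ, w σ ≠ 0 → ∀ v u, C v = 0 → C u ≠ 0 → (s(v, u) ∈ M σ ↔ σ v = u) := by
    intro σ hσ v u hv hu
    simp only [M, Finset.mem_image, Finset.mem_filter, Finset.mem_univ, true_and]
    constructor
    · rintro ⟨x, hx, h⟩
      rcases Sym2.eq_iff.1 h with ⟨rfl, h⟩ | ⟨rfl, -⟩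
      exacts [Sym2.congr_right.1 h, absurd hx hu]
    · rintro rfl
      exact ⟨v, hv, rfl⟩
  have heq : γ = ∑ σ with w σ ≠ 0, w σ • charF (M σ) := by
    funext e
    rw [Finset.sum_apply]
    by_cases he : e ∈ G.edgeSet
    · obtain ⟨v, u, rfl, hv, hu⟩ : ∃ v u, e = s(v, u) ∧ C v = 0 ∧ C u ≠ 0 := by
        induction e with
        | _ v u =>
          have hne := C.valid he
          by_cases hv : C v = 0
          · exact ⟨v, u, rfl, hv, fun h => hne (hv.trans h.symm)⟩
          · exact ⟨u, v, Sym2.eq_swap, by lia, hv⟩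
      rw [hent, Finset.sum_filter]
      refine Finset.sum_congr rfl fun σ _ => ?_
      by_cases hσ : w σ = 0
      · simp [hσ]
      · simp [hσ, charF, hcol σ hσ v u hv hu]
    · rw [hγ.2.1 e he, Finset.sum_eq_zero]
      intro σ hσ
      simp [(hM σ (Finset.mem_filter.1 hσ).2).isFPM.2.1 e he]
  rw [heq]
  refine (convex_convexHull ℝ _).sum_mem (fun σ _ => hw0 σ) ?_ fun σ hσ =>
    subset_convexHull ℝ _ ⟨M σ, hM σ (Finset.mem_filter.1 hσ).2, rfl⟩
  rw [Finset.sum_filter_ne_zero, hw1]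

/-- A linear functional takes on some perfect matching a value at least its value at a given
fractional perfect matching. -/
lemma IsFPM.exists_isPM_le (hbip : G.Colorable 2) {γ : Sym2 V → ℝ} (hγ : IsFPM G γ)
    (f : (Sym2 V → ℝ) →ₗ[ℝ] ℝ) : ∃ M, IsPM G M ∧ f γ ≤ f (charF M) := by
  obtain ⟨_, ⟨M, hM, rfl⟩, h⟩ := ConvexOn.exists_ge_of_mem_convexHull
    (f.convexOn convex_univ) (Set.subset_univ _) (hγ.mem_convexHull hbip)
  exact ⟨M, hM, h⟩

lemma IsForcingSet.isForcing_charF (hbip : G.Colorable 2) {M S : Finset (Sym2 V)}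
    (hM : IsPM G M) (hS : IsForcingSet G ↑S M) : IsForcing G (charF S) (charF M) := by
  have hSM : S ⊆ M := Finset.coe_subset.1 hS.1
  refine ⟨charF_nonneg S, fun e he => if_neg fun h => he (hM.1 (hSM h)), ?_, ?_⟩
  · exact (charF_le_iff_of_nonneg (charF_nonneg M)).2 fun e he => by simp [charF, hSM he]
  intro γ hγ hle
  rw [charF_le_iff_of_nonneg hγ.1] at hle
  have hsum : (S.card : ℝ) ≤ ∑ e ∈ S, γ e := by
    simpa using Finset.card_nsmul_le_sum S γ 1 hle
  have key : ∀ M', IsPM G M' → (S.card : ℝ) - 1 < ((S ∩ M').card : ℝ) → M' = M := by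
    intro M' hM' h
    refine hS.2 M' hM' (Finset.coe_subset.2 (Finset.inter_eq_left.1 ?_))
    refine Finset.eq_of_subset_of_card_le Finset.inter_subset_left ?_
    have : (S.card : ℝ) < ((S ∩ M').card + 1 : ℕ) := by push_cast; linarith
    exact Nat.lt_succ_iff.1 (Nat.cast_lt.1 this)
  have hcard : ∀ M', ((S ∩ M').card : ℝ) ≤ S.card := fun M' =>
    Nat.cast_le.2 (Finset.card_le_card Finset.inter_subset_left)
  have hup : ∀ e, γ e ≤ charF M e := by
    intro e
    obtain ⟨M', hM', h⟩ := hγ.exists_isPM_le hbip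
      (∑ x ∈ S, LinearMap.proj x + LinearMap.proj (R := ℝ) (φ := fun _ : Sym2 V => ℝ) e)
    simp only [LinearMap.add_apply, LinearMap.sum_apply, LinearMap.proj_apply, sum_charF] at h
    by_cases hlt : (S.card : ℝ) - 1 < ((S ∩ M').card : ℝ)
    · obtain rfl := key M' hM' hlt
      linarith [hcard M']
    · have h1 : charF M' e ≤ 1 := by unfold charF; split_ifs <;> norm_num
      linarith [charF_nonneg M e]
  exact (hγ.eq_of_le hM.isFPM hup).symm

lemma IsForcing.isForcingSet {α γ : Sym2 V → ℝ} (hγ : IsFPM G γ) (h : IsForcing G α γ)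
    {M : Finset (Sym2 V)} (hM : IsPM G M) :
    IsForcingSet G ↑(M.filter fun e => α e = γ e) M := by
  refine ⟨Finset.coe_subset.2 (Finset.filter_subset _ _), fun M' hM' hsub => ?_⟩
  have hlt : ∀ e ∈ M \ M', α e < γ e := fun e he => by
    obtain ⟨h1, h2⟩ := Finset.mem_sdiff.1 he
    exact lt_of_le_of_ne (h.2.2.1 e) fun h3 =>
      h2 (hsub (Finset.mem_coe.2 (Finset.mem_filter.2 ⟨h1, h3⟩)))
  obtain ⟨ε, hε, hεle⟩ : ∃ ε : ℝ, 0 < ε ∧ ∀ e ∈ M \ M', ε ≤ γ e - α e := by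
    rcases (M \ M').eq_empty_or_nonempty with h0 | h0
    · exact ⟨1, one_pos, by simp [h0]⟩
    · obtain ⟨e, he, hmin⟩ := Finset.exists_min_image _ (fun e => γ e - α e) h0
      exact ⟨_, sub_pos.2 (hlt e he), hmin⟩
  let δ : Sym2 V → ℝ := fun e => γ e + ε * (charF M' e - charF M e)
  have hle : α ≤ δ := fun e => by
    have h1 := h.2.2.1 e
    by_cases he : e ∈ M \ M'
    · have h2 := hεle e he
      rw [Finset.mem_sdiff] at he
      simp only [δ, charF, he.1, he.2, if_true, if_false]
      linarith
    · have h2 : 0 ≤ charF M' e - charF M e := by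
        rw [Finset.mem_sdiff, not_and_not_right] at he
        by_cases heM : e ∈ M
        · simp [charF, heM, he heM]
        · simpa [charF, heM] using charF_nonneg M' e
      exact h1.trans (le_add_of_nonneg_right (mul_nonneg hε.le h2))
  have hδ : IsFPM G δ := by
    refine ⟨fun e => (h.1 e).trans (hle e), fun e he => ?_, fun v => ?_⟩
    · simp [δ, hγ.2.1 e he, hM.isFPM.2.1 e he, hM'.isFPM.2.1 e he]
    · have : vertexSum G δ v = vertexSum G γ v
          + ε * (vertexSum G (charF M') v - vertexSum G (charF M) v) := by
        simp only [vertexSum, ← Finset.sum_sub_distrib, Finset.mul_sum,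
          ← Finset.sum_add_distrib]
        refine Finset.sum_congr rfl fun e _ => ?_
        split_ifs <;> simp [δ]
      rw [this, hγ.2.2, hM.isFPM.2.2, hM'.isFPM.2.2]
      simp
  have heq := h.2.2.2 δ hδ hle
  refine hM.eq_of_subset hM' fun e he => ?_
  by_contra he'
  have := congrFun heq e
  simp [δ, charF, he, he', hε.ne'] at this

lemma IsForcing.fMin_le_eSum (hbip : G.Colorable 2) {α γ : Sym2 V → ℝ} (hγ : IsFPM G γ)
    (h : IsForcing G α γ) : (fMin G : ℝ) ≤ eSum G α := by
  let T : Finset (Sym2 V) := G.edgeFinset.filter fun e => α e = γ e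
  obtain ⟨M, hM, hle⟩ := hγ.exists_isPM_le hbip
    (-∑ x ∈ T, LinearMap.proj (R := ℝ) (φ := fun _ : Sym2 V => ℝ) x)
  simp only [LinearMap.neg_apply, LinearMap.sum_apply, LinearMap.proj_apply, sum_charF,
    neg_le_neg_iff] at hle
  have hT : T ∩ M = M.filter fun e => α e = γ e := by
    ext e
    have : e ∈ M → e ∈ G.edgeSet := fun he => hM.1 he
    simp only [T, Finset.mem_inter, Finset.mem_filter, SimpleGraph.mem_edgeFinset]
    tauto
  calc (fMin G : ℝ) ≤ ((T ∩ M).card : ℝ) := by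
        rw [hT]
        exact Nat.cast_le.2 (fMin_le_card hM (h.isForcingSet hγ hM))
    _ ≤ ∑ e ∈ T, γ e := hle
    _ = ∑ e ∈ T, α e := Finset.sum_congr rfl fun e he => (Finset.mem_filter.1 he).2.symm
    _ ≤ eSum G α := Finset.sum_le_sum_of_subset_of_nonneg (Finset.filter_subset _ _)
        fun e _ _ => h.1 e

lemma IsFPM.fMin_le_ffN (hbip : G.Colorable 2) {γ : Sym2 V → ℝ} (hγ : IsFPM G γ) :
    (fMin G : ℝ) ≤ ffN G γ := by
  refine le_csInf ⟨_, γ, hγ.isForcing_self, rfl⟩ ?_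
  rintro _ ⟨α, hα, rfl⟩
  exact hα.fMin_le_eSum hbip hγ

lemma IsPM.ffN_charF_le_fN (hbip : G.Colorable 2) {M : Finset (Sym2 V)} (hM : IsPM G M) :
    ffN G (charF M) ≤ fN G M := by
  obtain ⟨S, hS, hcard⟩ := exists_isForcingSet_card_eq_fN hM
  refine csInf_le ⟨fMin G, ?_⟩ ⟨charF S, hS.isForcing_charF hbip hM, ?_⟩
  · rintro _ ⟨α, hα, rfl⟩
    exact hα.fMin_le_eSum hbip hM.isFPM
  · rw [eSum, sum_charF, Finset.inter_eq_right.2, hcard]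
    exact fun e he => SimpleGraph.mem_edgeFinset.2 (hM.1 (hS.1 he))

end

/-- For a bipartite graph with at least one perfect matching, `f_f(G) = f(G)`. -/
theorem ffMin_eq_fMin_of_bipartite (G : SimpleGraph V) [DecidableRel G.Adj]
    (hbip : G.Colorable 2) (hM : ∃ M, IsPM G M) :
    ffMin G = (fMin G : ℝ) := by
  have hlow : (fMin G : ℝ) ∈ lowerBounds {x : ℝ | ∃ γ, IsFPM G γ ∧ ffN G γ = x} := by
    rintro _ ⟨γ, hγ, rfl⟩
    exact hγ.fMin_le_ffN hbip
  obtain ⟨M, hM, hMin⟩ := exists_isPM_fN_eq_fMin hM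
  refine le_antisymm ?_ (le_csInf ⟨_, charF M, hM.isFPM, rfl⟩ hlow)
  rw [← hMin]
  exact (csInf_le ⟨_, hlow⟩ ⟨charF M, hM.isFPM, rfl⟩).trans (hM.ffN_charF_le_fN hbip)
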